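/- Let W be the Weierstrass curve over the field with 4 elements given by the coefficients a₁ = 0, a₂ = 0, a₃ = 1, a₄ = 1, a₆ = 1, i.e., the base change to F₄ of the elliptic curve y² + y = x³ + x + 1, and let R = F₄[X, Y]/(Y² + Y − (X³ + X + 1)) be its affine coordinate ring. Then the ideal class group of R has exactly 5 elements. -/

import Mathlib

open MvPolynomial in
/-- The affine coordinate ring `F[X, Y] ⧸ (Y² + Y - (X³ + X + 1))` of the elliptic curve
`y² + y = x³ + x + 1` over a field `F`, with `X := X 0` and `Y := X 1`. -/
abbrev heckeCoordRing (F : Type*) [Field F] : Type _ :=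
  MvPolynomial (Fin 2) F ⧸
    Ideal.span {(X 1 : MvPolynomial (Fin 2) F) ^ 2 + X 1 - ((X 0) ^ 3 + X 0 + 1)}

open Polynomial in
/-- The Weierstrass curve `y² + y = x³ + x + 1`. -/
abbrev heckeW (F : Type*) [Field F] : WeierstrassCurve.Affine F := ⟨0, 0, 1, 1, 1⟩

namespace HeckeAux
open Polynomial WeierstrassCurve.Affine
open scoped nonZeroDivisors Polynomial.Bivariate

variable {F : Type*} [Field F]

instance : Module.Finite F[X] (heckeW F).CoordinateRing :=
  Module.Finite.of_basis (CoordinateRing.basis (heckeW F))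

/-- The conjugation `Y ↦ -Y - 1`. -/
noncomputable def conj (F : Type*) [Field F] :
    (heckeW F).CoordinateRing →ₐ[F[X]] (heckeW F).CoordinateRing :=
  AdjoinRoot.liftAlgHom _ (Algebra.ofId _ _) (-(CoordinateRing.mk (heckeW F) Y) - 1) (by
    have h : CoordinateRing.mk (heckeW F) (heckeW F).polynomial = 0 := AdjoinRoot.mk_self
    simp only [WeierstrassCurve.Affine.polynomial, eval₂_add, eval₂_sub, eval₂_mul, eval₂_pow, eval₂_X, eval₂_C, map_add, map_sub,
      map_mul, map_pow, map_zero, map_one, eval₂_one, eval₂_zero] at h ⊢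
    have e : ∀ p : F[X], ((Algebra.ofId F[X] (heckeW F).CoordinateRing : _ →+* _)) p
      = CoordinateRing.mk (heckeW F) (C p) := fun p => rfl
    simp only [e, zero_mul] at h ⊢
    linear_combination h)

lemma conj_Y : conj F (CoordinateRing.mk (heckeW F) Y) = -(CoordinateRing.mk (heckeW F) Y) - 1 := by
  unfold conj
  exact AdjoinRoot.liftAlgHom_root ..

lemma conj_conj (z : (heckeW F).CoordinateRing) : conj F (conj F z) = z := by
  obtain ⟨p, q, rfl⟩ := CoordinateRing.exists_smul_basis_eq z
  simp only [map_add, map_smul, map_one, conj_Y, map_sub, map_neg]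
  congr 2
  ring

/-- a fraction integral over `F[X]` in the function field is a polynomial. -/
lemma dvd_of_integral {p b : F[X]} (hp : p ≠ 0) {w : (heckeW F).FunctionField}
    (hw : IsIntegral F[X] w)
    (h : algebraMap F[X] (heckeW F).FunctionField p * w = algebraMap _ _ b) : p ∣ b := by
  have hinj : Function.Injective (algebraMap F[X] (heckeW F).FunctionField) :=
    FaithfulSMul.algebraMap_injective _ _
  let g : F[X] →ₐ[F[X]] (heckeW F).FunctionField := Algebra.ofId _ _
  have hg : Function.Injective g := hinj
  let φ : FractionRing F[X] →ₐ[F[X]] (heckeW F).FunctionField := IsFractionRing.liftAlgHom hg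
  have hp' : algebraMap F[X] (FractionRing F[X]) p ≠ 0 := by
    simpa using hp
  have hp'' : algebraMap F[X] (heckeW F).FunctionField p ≠ 0 :=
    (map_ne_zero_iff _ hinj).mpr hp
  have hφ : φ (algebraMap F[X] (FractionRing F[X]) b / algebraMap F[X] (FractionRing F[X]) p) = w := by
    rw [map_div₀, AlgHom.commutes, AlgHom.commutes, div_eq_iff hp'', ← h, mul_comm]
  rw [← hφ, isIntegral_algHom_iff φ φ.toRingHom.injective, IsIntegrallyClosed.isIntegral_iff] at hw
  obtain ⟨c, hc⟩ := hw
  refine ⟨c, ?_⟩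
  apply IsFractionRing.injective F[X] (FractionRing F[X])
  rw [map_mul, hc]
  field_simp

lemma exists_poly_mul (s : (heckeW F).CoordinateRing) (hs : s ≠ 0) :
    ∃ (p : F[X]) (t : (heckeW F).CoordinateRing), p ≠ 0 ∧ s * t = algebraMap _ _ p := by
  obtain ⟨p, q, rfl⟩ := CoordinateRing.exists_smul_basis_eq s
  refine ⟨Algebra.norm F[X] (p • (1 : (heckeW F).CoordinateRing) + q • CoordinateRing.mk _ Y),
    CoordinateRing.mk _ (C p + C q * (-(Y : F[X][Y]) - C (C (heckeW F).a₁ * X + C (heckeW F).a₃))),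
    Algebra.norm_ne_zero_iff.mpr hs, ?_⟩
  refine Eq.trans ?_ (CoordinateRing.coe_norm_smul_basis p q).symm
  rw [map_mul (CoordinateRing.mk (heckeW F))]
  congr 1
  simp only [CoordinateRing.smul, map_add, map_mul, mul_one]

instance [CharP F 2] : IsDedekindDomain (heckeW F).CoordinateRing := by
  have : Ring.DimensionLEOne (heckeW F).CoordinateRing := Ring.DimensionLEOne.of_isIntegral F[X] _
  have : IsIntegrallyClosed (heckeW F).CoordinateRing := by
    rw [isIntegrallyClosed_iff (heckeW F).FunctionField]
    intro z hz
    replace hz : IsIntegral F[X] z := isIntegral_trans z hz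
    obtain ⟨r, s, hs, hrs⟩ := IsFractionRing.div_surjective (A := (heckeW F).CoordinateRing) z
    obtain ⟨p, t, hp, hst⟩ := exists_poly_mul s (nonZeroDivisors.ne_zero hs)
    have hs0 : algebraMap (heckeW F).CoordinateRing (heckeW F).FunctionField s ≠ 0 := by
      simpa using nonZeroDivisors.ne_zero hs
    obtain ⟨a, b, hab⟩ := CoordinateRing.exists_smul_basis_eq (r * t)
    have key : algebraMap F[X] (heckeW F).FunctionField p * z =
        algebraMap (heckeW F).CoordinateRing _ (a • 1 + b • CoordinateRing.mk _ Y) := by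
      rw [hab, IsScalarTower.algebraMap_apply F[X] (heckeW F).CoordinateRing, ← hst, ← hrs,
        map_mul, map_mul]
      field_simp
    have hσ : Function.Injective ((Algebra.ofId (heckeW F).CoordinateRing
        (heckeW F).FunctionField).restrictScalars F[X] |>.comp (conj F)) :=
      (IsFractionRing.injective (heckeW F).CoordinateRing (heckeW F).FunctionField).comp
        (Function.LeftInverse.injective conj_conj)
    let σ : (heckeW F).FunctionField →ₐ[F[X]] (heckeW F).FunctionField :=
      IsFractionRing.liftAlgHom hσ
    have hσa : ∀ u : (heckeW F).CoordinateRing, σ (algebraMap _ _ u) = algebraMap _ _ (conj F u) := by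
      intro u
      exact IsFractionRing.lift_algebraMap (g := ((Algebra.ofId (heckeW F).CoordinateRing
        (heckeW F).FunctionField).restrictScalars F[X] |>.comp (conj F)).toRingHom) hσ u
    have key2 := congrArg σ key
    rw [map_mul, AlgHom.commutes, hσa] at key2
    simp only [map_add, map_smul, conj_Y, map_one] at key key2
    set y := algebraMap (heckeW F).CoordinateRing (heckeW F).FunctionField
      (CoordinateRing.mk (heckeW F) Y) with hy
    simp only [Algebra.smul_def, map_mul, map_sub, map_neg, map_one, mul_one,
      ← IsScalarTower.algebraMap_apply F[X] (heckeW F).CoordinateRing (heckeW F).FunctionField,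
      ← hy] at key key2
    have hyint : IsIntegral F[X] y :=
      (Algebra.IsIntegral.isIntegral (R := F[X]) (CoordinateRing.mk (heckeW F) Y)).algebraMap
    have h2 : (2 : (heckeW F).FunctionField) = 0 := by
      have h := congrArg (algebraMap F[X] (heckeW F).FunctionField)
        (congrArg C (CharTwo.two_eq_zero (R := F)))
      rwa [map_ofNat, map_ofNat, map_zero, map_zero] at h
    obtain ⟨c, rfl⟩ : p ∣ b := by
      refine dvd_of_integral hp (hz.sub (hz.map σ)) ?_
      linear_combination key - key2 + algebraMap F[X] (heckeW F).FunctionField b * y * h2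
    obtain ⟨d, rfl⟩ : p ∣ a := by
      refine dvd_of_integral hp (hz.sub ((isIntegral_algebraMap (x := c)).mul hyint)) ?_
      rw [map_mul] at key
      linear_combination key
    refine ⟨d • 1 + c • CoordinateRing.mk _ Y, ?_⟩
    have hp'' : algebraMap F[X] (heckeW F).FunctionField p ≠ 0 :=
      (map_ne_zero_iff _ (FaithfulSMul.algebraMap_injective _ _)).mpr hp
    apply mul_left_cancel₀ hp''
    rw [key]
    simp only [Algebra.smul_def, map_add, map_mul, mul_one,
      ← IsScalarTower.algebraMap_apply F[X] (heckeW F).CoordinateRing (heckeW F).FunctionField,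
      ← hy]
    ring
  have : IsDedekindRing (heckeW F).CoordinateRing := IsDedekindRing.mk
  exact IsDedekindDomain.mk

lemma finiteDimensional_quotient {I : Ideal (heckeW F).CoordinateRing} (hI : I ≠ ⊥) :
    FiniteDimensional F ((heckeW F).CoordinateRing ⧸ I) := by
  classical
  have e := Ideal.quotientEquivDirectSum F (CoordinateRing.basis (heckeW F)) hI
  exact Module.Finite.equiv e.symm

lemma exists_small {I : Ideal (heckeW F).CoordinateRing} (hI : I ≠ ⊥) :
    ∃ f ∈ I, f ≠ 0 ∧ Module.finrank F ((heckeW F).CoordinateRing ⧸ Ideal.span {f}) ≤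
      Module.finrank F ((heckeW F).CoordinateRing ⧸ I) + 1 := by
  have := finiteDimensional_quotient hI
  set d := Module.finrank F ((heckeW F).CoordinateRing ⧸ I) with hd
  have fd : ∀ n, FiniteDimensional F (degreeLT F n) := fun n =>
    Module.Finite.equiv (degreeLTEquiv F n).symm
  have fr : ∀ n, Module.finrank F (degreeLT F n) = n := fun n => by
    rw [(degreeLTEquiv F n).finrank_eq, Module.finrank_fin_fun]
  let g : (degreeLT F ((d + 1) / 2 + 1) × degreeLT F (d / 2)) →ₗ[F] (heckeW F).CoordinateRing :=
    LinearMap.coprod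
      (((LinearMap.toSpanSingleton F[X] (heckeW F).CoordinateRing 1).restrictScalars F).comp
        (Submodule.subtype _))
      (((LinearMap.toSpanSingleton F[X] (heckeW F).CoordinateRing
        (CoordinateRing.mk _ Y)).restrictScalars F).comp (Submodule.subtype _))
  have hg : ∀ v, g v = (v.1 : F[X]) • 1 + (v.2 : F[X]) • CoordinateRing.mk _ Y := fun v => rfl
  let h := (Ideal.Quotient.mkₐ F I).toLinearMap.comp g
  have hker : LinearMap.ker h ≠ ⊥ := by
    apply LinearMap.ker_ne_bot_of_finrank_lt
    rw [Module.finrank_prod, fr, fr, ← hd]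
    omega
  obtain ⟨v, hv, hv0⟩ := (Submodule.ne_bot_iff _).mp hker
  have hne : g v ≠ 0 := by
    intro h0
    rw [hg] at h0
    obtain ⟨h1, h2⟩ := CoordinateRing.smul_basis_eq_zero h0
    exact hv0 (Prod.ext (Subtype.ext h1) (Subtype.ext h2))
  refine ⟨g v, ?_, hne, ?_⟩
  · exact Ideal.Quotient.eq_zero_iff_mem.mp hv
  · rw [finrank_quotient_span_eq_natDegree_norm (CoordinateRing.basis (heckeW F)) hne]
    apply natDegree_le_of_degree_le
    rw [hg, CoordinateRing.degree_norm_smul_basis]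
    have h1 := mem_degreeLT.mp v.1.2
    have h2 := mem_degreeLT.mp v.2.2
    apply max_le
    · cases hh : (v.1 : F[X]).degree with
      | bot => exact bot_le
      | coe n =>
        rw [hh] at h1
        have : n < (d + 1) / 2 + 1 := WithBot.coe_lt_coe.mp h1
        rw [two_nsmul]
        have h3 : n + n ≤ d + 1 := by omega
        exact WithBot.coe_le_coe.mpr h3
    · cases hh : (v.2 : F[X]).degree with
      | bot => exact bot_le
      | coe n =>
        rw [hh] at h2
        have : n < d / 2 := WithBot.coe_lt_coe.mp h2
        rw [two_nsmul]
        have h3 : n + n + 3 ≤ d + 1 := by omega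
        exact WithBot.coe_le_coe.mpr h3

lemma finrank_add_le [CharP F 2] {I J : Ideal (heckeW F).CoordinateRing} (hI : I ≠ ⊥)
    (hJ : J ≠ ⊥) :
    Module.finrank F ((heckeW F).CoordinateRing ⧸ J) +
      Module.finrank F ((heckeW F).CoordinateRing ⧸ I) ≤
      Module.finrank F ((heckeW F).CoordinateRing ⧸ (I * J)) := by
  have hIJ : I * J ≠ ⊥ := mul_ne_zero hI hJ
  have := finiteDimensional_quotient hIJ
  have := finiteDimensional_quotient hI
  have := finiteDimensional_quotient hJ
  obtain ⟨a, ha⟩ := IsDedekindDomain.exists_sup_span_eq (I := I * J) (J := I) Ideal.mul_le_left hIJ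
  have haI : a ∈ I := by
    rw [← ha]; exact Ideal.mem_sup_right (Ideal.mem_span_singleton_self a)
  let π : ((heckeW F).CoordinateRing ⧸ (I * J)) →ₗ[F] ((heckeW F).CoordinateRing ⧸ I) :=
    (Ideal.Quotient.factorₐ F (Ideal.mul_le_left : I * J ≤ I)).toLinearMap
  have hπ : Function.Surjective π := 
    Ideal.Quotient.factor_surjective (Ideal.mul_le_left : I * J ≤ I)
  let m : (heckeW F).CoordinateRing →ₗ[F] ((heckeW F).CoordinateRing ⧸ (I * J)) :=
    (Ideal.Quotient.mkₐ F (I * J)).toLinearMap.comp (LinearMap.mulRight F a)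
  have hm : ∀ r, m r = Ideal.Quotient.mk (I * J) (r * a) := fun r => rfl
  have hker : (LinearMap.ker m) = J.restrictScalars F := by
    ext r
    rw [LinearMap.mem_ker, hm, Ideal.Quotient.eq_zero_iff_mem, Submodule.restrictScalars_mem]
    constructor
    · intro hr
      have : Ideal.span {r} * I ≤ J * I := by
        rw [← ha, Ideal.mul_sup, ha]
        apply sup_le
        · rw [mul_comm J I]; exact Ideal.mul_le_right
        · rw [Ideal.span_singleton_mul_span_singleton, Ideal.span_singleton_le_iff_mem, mul_comm J]
          exact hr
      rw [← Ideal.dvd_iff_le, mul_comm J, mul_comm _ I] at this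
      have h2 := (mul_dvd_mul_iff_left (show I ≠ 0 from hI)).mp this
      rw [Ideal.dvd_iff_le, Ideal.span_singleton_le_iff_mem] at h2
      exact h2
    · intro hr
      rw [mul_comm]
      exact Ideal.mul_mem_mul hr haI
  have hrange : LinearMap.range m ≤ LinearMap.ker π := by
    rintro _ ⟨r, rfl⟩
    rw [LinearMap.mem_ker, hm]
    exact Ideal.Quotient.eq_zero_iff_mem.mpr (I.mul_mem_left _ haI)
  have e1 : Module.finrank F ((heckeW F).CoordinateRing ⧸ J) =
      Module.finrank F (LinearMap.range m) := by
    rw [← m.quotKerEquivRange.finrank_eq, hker]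
    rfl
  have e2 := π.finrank_range_add_finrank_ker
  rw [LinearMap.range_eq_top.mpr hπ, finrank_top] at e2
  have e3 := Submodule.finrank_mono hrange
  omega

instance [CharP F 2] : (heckeW F).IsElliptic := by
  refine ⟨?_⟩
  have h2 : (2 : F) = 0 := CharTwo.two_eq_zero
  have : (heckeW F).Δ = 1 := by
    simp only [WeierstrassCurve.Δ, WeierstrassCurve.b₂, WeierstrassCurve.b₄, WeierstrassCurve.b₆,
      WeierstrassCurve.b₈]
    linear_combination (-370) * h2
  rw [this]
  exact isUnit_one

/-- ideals of codimension one are points -/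
lemma eq_XYIdeal {J : Ideal (heckeW F).CoordinateRing}
    (hJ : Module.finrank F ((heckeW F).CoordinateRing ⧸ J) = 1) :
    ∃ x y, (heckeW F).Equation x y ∧ CoordinateRing.XYIdeal (heckeW F) x (C y) = J := by
  have hbij : Function.Bijective (algebraMap F ((heckeW F).CoordinateRing ⧸ J)) :=
    have : FiniteDimensional F ((heckeW F).CoordinateRing ⧸ J) :=
      FiniteDimensional.of_finrank_pos (by omega)
    have : Nontrivial ((heckeW F).CoordinateRing ⧸ J) :=
      Module.nontrivial_of_finrank_pos (R := F) (by omega)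
    have hi : Function.Injective (Algebra.linearMap F ((heckeW F).CoordinateRing ⧸ J)) :=
      (algebraMap F ((heckeW F).CoordinateRing ⧸ J)).injective
    ⟨hi, (LinearMap.injective_iff_surjective_of_finrank_eq_finrank
      (by rw [hJ, Module.finrank_self])).mp hi⟩
  obtain ⟨x, hx⟩ := hbij.2 (Ideal.Quotient.mk J (CoordinateRing.mk _ (C X)))
  obtain ⟨y, hy⟩ := hbij.2 (Ideal.Quotient.mk J (CoordinateRing.mk _ Y))
  have halg : ∀ c : F, algebraMap F ((heckeW F).CoordinateRing ⧸ J) c =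
    Ideal.Quotient.mk J (CoordinateRing.mk _ (C (C c))) := fun c => rfl
  have heq : (heckeW F).Equation x y := by
    have h : CoordinateRing.mk (heckeW F) (heckeW F).polynomial = 0 := AdjoinRoot.mk_self
    have h' := congrArg (Ideal.Quotient.mk J) h
    simp only [WeierstrassCurve.Affine.polynomial, map_add, map_sub, map_mul, map_pow, ← hx, ← hy,
      ← halg, map_zero] at h'
    rw [equation_iff]
    apply hbij.1
    simp only [map_add, map_mul, map_pow, map_zero]
    linear_combination h'
  refine ⟨x, y, heq, ?_⟩
  have hle : CoordinateRing.XYIdeal (heckeW F) x (C y) ≤ J := by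
    rw [CoordinateRing.XYIdeal, Ideal.span_le]
    rintro _ (rfl | rfl)
    · rw [SetLike.mem_coe, ← Ideal.Quotient.eq_zero_iff_mem, CoordinateRing.XClass, map_sub, map_sub,
        map_sub, ← hx, halg, sub_self]
    · rw [SetLike.mem_coe, ← Ideal.Quotient.eq_zero_iff_mem, CoordinateRing.YClass, map_sub, map_sub,
        ← hy, halg, sub_self]
  have hmax : (CoordinateRing.XYIdeal (heckeW F) x (C y)).IsMaximal :=
    Ideal.Quotient.maximal_of_isField _
      ((CoordinateRing.quotientXYIdealEquiv heq).toMulEquiv.isField (Field.toIsField F))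
  refine hmax.eq_of_le ?_ hle
  rintro rfl
  rw [Module.finrank_zero_of_subsingleton] at hJ
  exact zero_ne_one hJ

lemma toClass_surjective [CharP F 2] [DecidableEq F] :
    Function.Surjective (Point.toClass (W := heckeW F)) := by
  intro c
  change ClassGroup _ at c
  obtain ⟨⟨I, hI⟩, hIc⟩ := ClassGroup.mk0_surjective c
  have hI0 : I ≠ ⊥ := nonZeroDivisors.ne_zero hI
  obtain ⟨f, hfI, hf0, hf⟩ := exists_small hI0
  obtain ⟨J, hJ⟩ := Ideal.dvd_iff_le.mpr ((Ideal.span_singleton_le_iff_mem I).mpr hfI)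
  have hf0' : Ideal.span {f} ≠ ⊥ := by simpa using hf0
  have hJ0 : J ≠ ⊥ := by
    rintro rfl
    apply hf0'
    rw [hJ]
    exact mul_zero I
  have h1 := finrank_add_le hI0 hJ0
  rw [← hJ] at h1
  have hJn : J ∈ (Ideal (heckeW F).CoordinateRing)⁰ := mem_nonZeroDivisors_of_ne_zero hJ0
  have hmul : ClassGroup.mk0 ⟨I, hI⟩ * ClassGroup.mk0 ⟨J, hJn⟩ = 1 := by
    rw [← map_mul]
    refine (ClassGroup.mk0_eq_one_iff (mul_mem hI hJn)).mpr ?_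
    rw [← hJ]
    exact ⟨f, rfl⟩
  have hJle : Module.finrank F ((heckeW F).CoordinateRing ⧸ J) ≤ 1 := by omega
  obtain ⟨P, hP⟩ : ∃ P, Point.toClass (W := heckeW F) P =
      Additive.ofMul (ClassGroup.mk0 ⟨J, hJn⟩) := by
    rcases Nat.le_one_iff_eq_zero_or_eq_one.mp hJle with h0 | h1
    · have := finiteDimensional_quotient hJ0
      have hs := Module.finrank_zero_iff.mp h0
      have hJt : J = ⊤ := Ideal.Quotient.subsingleton_iff.mp hs
      subst hJt
      refine ⟨0, ?_⟩
      rw [map_zero]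
      symm
      exact (ClassGroup.mk0_eq_one_iff hJn).mpr ⟨1, by simp⟩
    · obtain ⟨x, y, hxy, rfl⟩ := eq_XYIdeal h1
      refine ⟨.some x y (equation_iff_nonsingular.mp hxy), ?_⟩
      rw [Point.toClass_some, ← ClassGroup.mk_mk0 (heckeW F).FunctionField]
      refine congrArg (fun u => Additive.ofMul (ClassGroup.mk (heckeW F).FunctionField u)) ?_
      ext1
      rfl
  refine ⟨-P, ?_⟩
  have hmul' : Additive.ofMul (ClassGroup.mk0 ⟨I, hI⟩) + Additive.ofMul (ClassGroup.mk0 ⟨J, hJn⟩) = 0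
    := hmul
  rw [map_neg, hP]
  refine Eq.trans ?_ (congrArg Additive.ofMul hIc)
  rw [neg_eq_iff_add_eq_zero, add_comm]
  exact hmul'

lemma card_points [CharP F 2] (h4 : Nat.card F = 4) : Nat.card (heckeW F).Point = 5 := by
  classical
  have : Finite F := Nat.finite_of_card_ne_zero (by omega)
  have := Fintype.ofFinite F
  have hc : Fintype.card F = 4 := by rw [← Nat.card_eq_fintype_card, h4]
  have h2 : (2 : F) = 0 := CharTwo.two_eq_zero
  have hpow : ∀ a : F, a ^ 4 = a := fun a => by
    have := FiniteField.pow_card a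
    rwa [hc] at this
  obtain ⟨w, hw⟩ : ∃ w : F, w ∉ ({0, 1} : Finset F) := by
    by_contra! hcon
    have h1 := Finset.card_le_card (fun a _ => hcon a : (Finset.univ : Finset F) ⊆ {0, 1})
    have h3 := Finset.card_le_two (a := (0 : F)) (b := 1)
    rw [Finset.card_univ, hc] at h1
    omega
  simp only [Finset.mem_insert, Finset.mem_singleton, not_or] at hw
  have hw2 : w ^ 2 + w + 1 = 0 := by
    have h : w * (w - 1) * (w ^ 2 + w + 1) = 0 := by linear_combination hpow w
    exact (mul_eq_zero.mp h).resolve_left (mul_ne_zero hw.1 (sub_ne_zero.mpr hw.2))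
  have hset : {xy : F × F | (heckeW F).Equation xy.1 xy.2} =
      (({0, 1} : Finset F) ×ˢ ({w, w + 1} : Finset F) : Finset (F × F)) := by
    ext ⟨x, y⟩
    simp only [Set.mem_ofPred_eq, equation_iff, Finset.coe_product, Set.mem_prod, Finset.mem_coe,
      Finset.mem_insert, Finset.mem_singleton]
    constructor
    · intro h
      have hx : x * (x - 1) = 0 := by
        have hy := hpow y
        have hx := hpow x
        have e : y ^ 2 + y = x ^ 3 + x + 1 := by linear_combination h
        have e2 : (x ^ 3 + x + 1) ^ 2 = x ^ 3 + x + 1 := by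
          rw [← e]
          linear_combination hy + (y ^ 3 + y ^ 2 - y ^ 2) * h2
        linear_combination e2 - x ^ 2 * hx - (x ^ 4 + x ^ 3 + x) * h2
      have hx' : x = 0 ∨ x = 1 := by
        rcases mul_eq_zero.mp hx with h0 | h0
        · exact Or.inl h0
        · exact Or.inr (sub_eq_zero.mp h0)
      refine ⟨hx', ?_⟩
      have hy : (y - w) * (y - (w + 1)) = 0 := by
        have hy1 : y ^ 2 + y = 1 := by
          rcases hx' with rfl | rfl
          · linear_combination h
          · linear_combination h + h2
        linear_combination hy1 + hw2 - (y + y * w) * h2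
      rcases mul_eq_zero.mp hy with h0 | h0
      · exact Or.inl (sub_eq_zero.mp h0)
      · exact Or.inr (sub_eq_zero.mp h0)
    · rintro ⟨rfl | rfl, rfl | rfl⟩
      · linear_combination hw2 - h2
      · linear_combination hw2 + w * h2
      · linear_combination hw2 - 2 * h2
      · linear_combination hw2 + (w - 1) * h2
  have hcard : Nat.card {xy : F × F // (heckeW F).Equation xy.1 xy.2} = 4 := by
    change Nat.card ({xy : F × F | (heckeW F).Equation xy.1 xy.2} : Set (F × F)) = 4
    rw [hset, Nat.card_eq_card_toFinset, Finset.toFinset_coe, Finset.card_product,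
      Finset.card_pair zero_ne_one, Finset.card_pair (by simp)]
  rw [Nat.card_congr (pointEquiv (heckeW F))]
  change Nat.card (Option {xy : F × F // (heckeW F).Equation xy.1 xy.2}) = 5
  rw [Finite.card_option, hcard]

/-- The two presentations of the coordinate ring agree. -/
noncomputable def coordEquiv (F : Type*) [Field F] :
    heckeCoordRing F ≃+* (heckeW F).CoordinateRing := by
  have hrel : CoordinateRing.mk (heckeW F) (heckeW F).polynomial = 0 := AdjoinRoot.mk_self
  simp only [WeierstrassCurve.Affine.polynomial, map_add, map_sub, map_mul, map_pow, map_zero,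
    map_one] at hrel
  let f₀ : MvPolynomial (Fin 2) F →ₐ[F] (heckeW F).CoordinateRing :=
    MvPolynomial.aeval ![CoordinateRing.mk (heckeW F) (C X), CoordinateRing.mk (heckeW F) Y]
  let f : heckeCoordRing F →ₐ[F] (heckeW F).CoordinateRing :=
    Ideal.Quotient.liftₐ _ f₀ (by
      intro a ha
      have hle : Ideal.span {(MvPolynomial.X 1 : MvPolynomial (Fin 2) F) ^ 2 + MvPolynomial.X 1 -
          ((MvPolynomial.X 0) ^ 3 + MvPolynomial.X 0 + 1)} ≤ RingHom.ker f₀ := by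
        rw [Ideal.span_singleton_le_iff_mem, RingHom.mem_ker]
        simp only [f₀, map_add, map_sub, map_pow, MvPolynomial.aeval_X, map_one,
          Matrix.cons_val_zero, Matrix.cons_val_one]
        linear_combination hrel
      exact hle ha)
  let q : MvPolynomial (Fin 2) F →ₐ[F] heckeCoordRing F := Ideal.Quotient.mkₐ F _
  let g₀ : F[X] →ₐ[F] heckeCoordRing F := Polynomial.aeval (q (MvPolynomial.X 0))
  have hq : q ((MvPolynomial.X 1) ^ 2 + MvPolynomial.X 1 -
          ((MvPolynomial.X 0) ^ 3 + MvPolynomial.X 0 + 1)) = 0 :=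
    Ideal.Quotient.eq_zero_iff_mem.mpr (Ideal.mem_span_singleton_self _)
  let g : (heckeW F).CoordinateRing →+* heckeCoordRing F :=
    AdjoinRoot.lift g₀.toRingHom (q (MvPolynomial.X 1)) (by
      simp only [map_add, map_sub, map_pow, map_one] at hq
      simp only [WeierstrassCurve.Affine.polynomial, eval₂_add, eval₂_sub, eval₂_mul, eval₂_pow,
        eval₂_X, eval₂_C]
      simp [g₀]
      linear_combination hq)
  refine RingEquiv.ofRingHom f.toRingHom g ?_ ?_
  · have hfq : ∀ a, f (q a) = f₀ a := fun a => rfl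
    have hgC : ∀ p : F[X], g (CoordinateRing.mk (heckeW F) (C p)) = g₀ p := fun p =>
      AdjoinRoot.lift_of _
    have hgY : g (CoordinateRing.mk (heckeW F) Y) = q (MvPolynomial.X 1) := AdjoinRoot.lift_root _
    have hfg : ∀ p : F[X], f (g₀ p) = CoordinateRing.mk (heckeW F) (C p) := by
      have h : f.comp g₀ = (Algebra.ofId F[X] (heckeW F).CoordinateRing).restrictScalars F := by
        apply Polynomial.algHom_ext
        simp only [AlgHom.comp_apply, g₀, Polynomial.aeval_X, hfq, f₀, MvPolynomial.aeval_X]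
        rfl
      exact fun p => DFunLike.congr_fun h p
    apply RingHom.ext
    intro z
    obtain ⟨a, b, rfl⟩ := CoordinateRing.exists_smul_basis_eq z
    simp only [CoordinateRing.smul, RingHom.comp_apply, RingHom.id_apply, map_add, map_mul, map_one,
      hgC, hgY]
    change f (g₀ a) * 1 + f (g₀ b) * f (q (MvPolynomial.X 1)) = _
    rw [hfg, hfg, hfq]
    simp [f₀]
  · apply Ideal.Quotient.ringHom_ext
    apply MvPolynomial.ringHom_ext
    · intro c
      change g (f₀ (MvPolynomial.C c)) = q (MvPolynomial.C c)
      rw [← MvPolynomial.algebraMap_eq, AlgHom.commutes, AlgHom.commutes]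
      exact (AdjoinRoot.lift_of (x := C c) _).trans (g₀.commutes c)
    · intro i
      change g (f₀ (MvPolynomial.X i)) = q (MvPolynomial.X i)
      fin_cases i
      · simp only [f₀, MvPolynomial.aeval_X]
        exact (AdjoinRoot.lift_of (x := X) _).trans (Polynomial.aeval_X _)
      · simp only [f₀, MvPolynomial.aeval_X]
        exact AdjoinRoot.lift_root _

end HeckeAux

/-- Let `R = F₄[X, Y] ⧸ (Y² + Y - (X³ + X + 1))` be the affine coordinate
ring of the base change to `F₄` of the elliptic curve `y² + y = x³ + x + 1`. Then the ideal
class group of `R` has exactly `5` elements. -/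
theorem heckeCoordRing_F4_classGroup_card_eq_five
    [IsDomain (heckeCoordRing (GaloisField 2 2))] :
    Nat.card (ClassGroup (heckeCoordRing (GaloisField 2 2))) = 5 := by
  classical
  rw [Nat.card_congr (ClassGroup.mulEquiv (HeckeAux.coordEquiv (GaloisField 2 2))).toEquiv,
    ← HeckeAux.card_points (F := GaloisField 2 2) (by rw [GaloisField.card 2 2 two_ne_zero]; norm_num)]
  exact (Nat.card_congr (Equiv.ofBijective _
    ⟨WeierstrassCurve.Affine.Point.toClass_injective, HeckeAux.toClass_surjective⟩)).symm
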